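/- For any hyperprior 𝒫, any λ > 0, any τ > 0 and any δ ∈ (0,1], with probability at least 1 − δ over the training sets D₁,…,Dₙ, simultaneously for all hyperposteriors 𝒬: R̃(𝒬) ≥ R̂_τ(𝒬) − (1/(nλ))·D_KL(𝒬||𝒫) − (1/(nmλ))·E_{P~𝒬}[Σ_{i=1}^n Σ_{j=1}^m D_KL(A(D_i^{:j−1},P)||P)] − λ(1+τ)²/(8m) − (1/(nλ))·ln(m/δ). -/

import Mathlib

open MeasureTheory
open scoped ENNReal

lemma aux_hoeff (p t : ℝ) (hp0 : 0 ≤ p) (hp1 : p ≤ 1) :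
    (1 - p) * Real.exp (-(t * p)) + p * Real.exp (t * (1 - p)) ≤ Real.exp (t ^ 2 / 8) := by
  let ν : Measure ℝ := ENNReal.ofReal (1 - p) • Measure.dirac 0 + ENNReal.ofReal p • Measure.dirac 1
  have hν : IsProbabilityMeasure ν := by
    constructor
    simp only [ν, Measure.coe_add, Measure.coe_smul, Pi.add_apply, Pi.smul_apply, measure_univ,
      smul_eq_mul, mul_one]
    rw [← ENNReal.ofReal_add (by linarith) hp0]
    simp
  have hint : ∀ f : ℝ → ℝ, ∫ x, f x ∂ν = (1 - p) * f 0 + p * f 1 := by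
    intro f
    have h1 : Integrable f (ENNReal.ofReal (1 - p) • Measure.dirac 0) :=
      (integrable_dirac (by simp)).smul_measure (by simp)
    have h2 : Integrable f (ENNReal.ofReal p • Measure.dirac 1) :=
      (integrable_dirac (by simp)).smul_measure (by simp)
    simp only [ν]
    rw [integral_add_measure h1 h2, integral_smul_measure, integral_smul_measure]
    simp [ENNReal.toReal_ofReal, hp0, hp1]
  have hb : ∀ᵐ x ∂ν, id x ∈ Set.Icc (0 : ℝ) 1 := by
    simp only [ν]
    rw [ae_add_measure_iff]
    constructor
    · apply Measure.ae_smul_measure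
      refine (ae_dirac_iff (measurableSet_Icc (a := (0 : ℝ)) (b := 1))).2 ?_; simp
    · apply Measure.ae_smul_measure
      refine (ae_dirac_iff (measurableSet_Icc (a := (0 : ℝ)) (b := 1))).2 ?_; simp
  have h := (ProbabilityTheory.hasSubgaussianMGF_of_mem_Icc (X := id) (μ := ν)
    measurable_id.aemeasurable hb).mgf_le t
  rw [ProbabilityTheory.mgf, hint, hint] at h
  simp only [id, mul_zero, mul_one, zero_add] at h
  convert h using 2
  · congr 2 <;> ring_nf
  · simp; ring

lemma aux_finDV {𝒜 : Type*} [Fintype 𝒜] (A p g : 𝒜 → ℝ) (hA : ∀ a, 0 ≤ A a)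
    (hA1 : ∑ a, A a = 1) (hp : ∀ a, 0 < p a) :
    ∑ a, A a * g a ≤ ∑ a, A a * Real.log (A a / p a)
      + Real.log (∑ a, p a * Real.exp (g a)) := by
  have hne : (Finset.univ : Finset 𝒜).Nonempty := by
    by_contra h
    rw [Finset.not_nonempty_iff_eq_empty] at h
    simp [h] at hA1
  set Z := ∑ a, p a * Real.exp (g a) with hZ
  have hZpos : 0 < Z := Finset.sum_pos (fun a _ => mul_pos (hp a) (Real.exp_pos _)) hne
  have key : ∀ a, A a * (g a - Real.log (A a / p a) - Real.log Z)
      ≤ p a * Real.exp (g a) / Z - A a := by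
    intro a
    rcases (hA a).eq_or_lt with h | h
    · rw [← h]
      have := mul_pos (hp a) (Real.exp_pos (g a))
      have := div_pos this hZpos
      linarith
    · have h1 := Real.add_one_le_exp (g a - Real.log (A a / p a) - Real.log Z)
      rw [Real.exp_sub, Real.exp_sub, Real.exp_log hZpos, Real.exp_log (div_pos h (hp a))] at h1
      have h2 := mul_le_mul_of_nonneg_left h1 h.le
      have h3 : A a * (Real.exp (g a) / (A a / p a) / Z) = p a * Real.exp (g a) / Z := by
        have := (hp a).ne'
        field_simp
      rw [h3] at h2
      linarith
  have hs := Finset.sum_le_sum (fun a (_ : a ∈ Finset.univ) => key a)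
  simp only [mul_sub, Finset.sum_sub_distrib, ← Finset.sum_mul, ← Finset.sum_div] at hs
  rw [hA1, ← hZ, div_self hZpos.ne'] at hs
  linarith

lemma aux_DV {Θ : Type*} [MeasurableSpace Θ] (P Q : Measure Θ) [IsProbabilityMeasure P]
    [IsProbabilityMeasure Q] (hQP : Q ≪ P)
    (hl : Integrable (fun θ => Real.log ((Q.rnDeriv P θ).toReal)) Q)
    (h : Θ → ℝ) (hm : Measurable h) (B : ℝ) (hB : ∀ θ, |h θ| ≤ B) :
    ∫ θ, h θ ∂Q ≤ ∫ θ, Real.log ((Q.rnDeriv P θ).toReal) ∂Q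
      + Real.log (∫ θ, Real.exp (h θ) ∂P) := by
  have hiQ : Integrable h Q := Integrable.of_bound hm.aestronglyMeasurable B
    (Filter.Eventually.of_forall hB)
  have hieP : Integrable (fun θ => Real.exp (h θ)) P :=
    Integrable.of_bound hm.exp.aestronglyMeasurable (Real.exp B)
    (Filter.Eventually.of_forall fun θ => by
      rw [Real.norm_eq_abs, Real.abs_exp]
      exact Real.exp_le_exp.2 (le_trans (le_abs_self _) (hB θ)))
  have hZpos : 0 < ∫ θ, Real.exp (h θ) ∂P := integral_exp_pos hieP
  set Z := ∫ θ, Real.exp (h θ) ∂P with hZ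
  let f := fun θ => (Q.rnDeriv P θ).toReal
  have hfm : Measurable f := (Measure.measurable_rnDeriv Q P).ennreal_toReal
  let e := fun θ => Real.exp (h θ - Real.log (f θ) - Real.log Z)
  have hem : Measurable e := ((hm.sub hfm.log).sub_const _).exp
  have hfe0 : ∀ θ, 0 ≤ f θ • e θ := fun θ =>
    mul_nonneg ENNReal.toReal_nonneg (Real.exp_pos _).le
  have hfe : ∀ θ, f θ • e θ ≤ Real.exp (h θ) / Z := by
    intro θ
    have h0 : 0 ≤ f θ := ENNReal.toReal_nonneg
    simp only [smul_eq_mul, e]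
    rcases h0.eq_or_lt with h' | h'
    · rw [← h', zero_mul]; positivity
    · rw [Real.exp_sub, Real.exp_sub, Real.exp_log hZpos, Real.exp_log h']
      apply le_of_eq; field_simp
  have hife : Integrable (fun θ => f θ • e θ) P := by
    refine Integrable.mono' (hieP.div_const Z) (hfm.smul hem).aestronglyMeasurable
      (Filter.Eventually.of_forall fun θ => ?_)
    rw [Real.norm_eq_abs, abs_of_nonneg (hfe0 θ)]
    exact hfe θ
  have hie : Integrable e Q := (integrable_rnDeriv_smul_iff hQP).1 hife
  have he : ∫ θ, e θ ∂Q ≤ 1 := by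
    rw [← integral_rnDeriv_smul hQP]
    calc _ ≤ ∫ θ, Real.exp (h θ) / Z ∂P := integral_mono hife (hieP.div_const Z) hfe
      _ = 1 := by rw [integral_div, ← hZ, div_self hZpos.ne']
  have hmain : ∫ θ, (h θ - Real.log (f θ) - Real.log Z) ∂Q ≤ ∫ θ, (e θ - 1) ∂Q := by
    apply integral_mono ((hiQ.sub hl).sub (integrable_const _)) (hie.sub (integrable_const _))
    intro θ
    have := Real.add_one_le_exp (h θ - Real.log (f θ) - Real.log Z)
    change h θ - Real.log (f θ) - Real.log Z
      ≤ Real.exp (h θ - Real.log (f θ) - Real.log Z) - 1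
    linarith
  have hd : Integrable (fun θ => h θ - Real.log (f θ)) Q := hiQ.sub hl
  rw [integral_sub hie (integrable_const _), integral_sub hd (integrable_const _),
    integral_sub hiQ hl] at hmain
  simp at hmain
  linarith

lemma aux_step {Ω : Type*} [m0 : MeasurableSpace Ω] (μ : Measure Ω) [IsProbabilityMeasure μ]
    (F : MeasurableSpace Ω) (hF : F ≤ m0) (Y R G : Ω → ℝ) (L s B : ℝ) (hL : 1 ≤ L) (hs : 0 ≤ s)
    (hY : Measurable[m0] Y) (hY0 : ∀ ω, 0 ≤ Y ω) (hYL : ∀ ω, Y ω ≤ L)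
    (hR : Measurable[F] R) (hR0 : ∀ ω, 0 ≤ R ω) (hR1 : ∀ ω, R ω ≤ 1)
    (hG : Measurable[F] G) (hG0 : ∀ ω, 0 ≤ G ω) (hGB : ∀ ω, G ω ≤ B)
    (hsup : ∀ᵐ ω ∂μ, (μ[fun ω => Y ω - R ω | F]) ω ≤ 0) :
    ∫ ω, G ω * Real.exp (s * (Y ω - R ω)) ∂μ ≤ Real.exp ((s * L) ^ 2 / 8) * ∫ ω, G ω ∂μ := by
  have hL0 : 0 < L := by linarith
  have hRm := hR.mono hF le_rfl
  have hGm := hG.mono hF le_rfl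
  let c : Ω → ℝ := fun ω => G ω * (Real.exp (-(s * R ω)) * ((Real.exp (s * L) - 1) / L))
  have hcF : Measurable[F] c := by
    have : Measurable[F] fun ω => Real.exp (-(s * R ω)) :=
      Real.measurable_exp.comp ((hR.const_mul s).neg)
    exact hG.mul (this.mul_const _)
  have hel : 0 ≤ (Real.exp (s * L) - 1) / L :=
    div_nonneg (by linarith [Real.one_le_exp (mul_nonneg hs hL0.le)]) hL0.le
  have hc0 : ∀ ω, 0 ≤ c ω := fun ω => mul_nonneg (hG0 ω) (mul_nonneg (Real.exp_pos _).le hel)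
  have hcB : ∀ ω, c ω ≤ B * (1 * ((Real.exp (s * L) - 1) / L)) := by
    intro ω
    have : Real.exp (-(s * R ω)) ≤ 1 := Real.exp_le_one_iff.2 (by
      have := mul_nonneg hs (hR0 ω); linarith)
    exact mul_le_mul (hGB ω) (mul_le_mul_of_nonneg_right this hel)
      (mul_nonneg (Real.exp_pos _).le hel) ((hG0 ω).trans (hGB ω))
  have hXi : Integrable (fun ω => Y ω - R ω) μ :=
    Integrable.of_bound (hY.sub hRm).aestronglyMeasurable (L + 1)
      (Filter.Eventually.of_forall fun ω => by
        rw [Real.norm_eq_abs, abs_le]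
        constructor <;> linarith [hY0 ω, hYL ω, hR0 ω, hR1 ω])
  have hcXi : Integrable (c * fun ω => Y ω - R ω) μ := by
    refine Integrable.bdd_mul (c := B * (1 * ((Real.exp (s * L) - 1) / L))) hXi
      (hcF.mono hF le_rfl).aestronglyMeasurable (Filter.Eventually.of_forall fun ω => ?_)
    rw [Real.norm_eq_abs, abs_of_nonneg (hc0 ω)]
    exact hcB ω
  have hcX : ∫ ω, c ω * (Y ω - R ω) ∂μ ≤ 0 := by
    have h1 := condExp_mul_of_stronglyMeasurable_left (m := F) (μ := μ)
      hcF.stronglyMeasurable hcXi hXi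
    have h2 : ∫ ω, c ω * (Y ω - R ω) ∂μ = ∫ ω, (μ[c * fun ω => Y ω - R ω | F]) ω ∂μ := by
      rw [integral_condExp hF]; rfl
    rw [h2, integral_congr_ae h1]
    apply integral_nonpos_of_ae
    filter_upwards [hsup] with ω hω
    exact mul_nonpos_of_nonneg_of_nonpos (hc0 ω) hω
  have hGi : Integrable G μ := Integrable.of_bound hGm.aestronglyMeasurable B
    (Filter.Eventually.of_forall fun ω => by
      rw [Real.norm_eq_abs, abs_of_nonneg (hG0 ω)]; exact hGB ω)
  have hpt : ∀ ω, G ω * Real.exp (s * (Y ω - R ω))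
      ≤ Real.exp ((s * L) ^ 2 / 8) * G ω + c ω * (Y ω - R ω) := by
    intro ω
    have hcv := convexOn_exp.2 (Set.mem_univ (-(s * R ω))) (Set.mem_univ (s * (L - R ω)))
      (show 0 ≤ 1 - Y ω / L by
        rw [sub_nonneg, div_le_one hL0]; exact hYL ω) (div_nonneg (hY0 ω) hL0.le) (by ring)
    simp only [smul_eq_mul] at hcv
    have e1 : (1 - Y ω / L) * -(s * R ω) + Y ω / L * (s * (L - R ω)) = s * (Y ω - R ω) := by
      field_simp; ring
    rw [e1] at hcv
    have hh := aux_hoeff (R ω / L) (s * L) (div_nonneg (hR0 ω) hL0.le)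
      (by rw [div_le_one hL0]; linarith [hR1 ω])
    have e2 : s * L * (R ω / L) = s * R ω := by field_simp
    have e3 : s * L * (1 - R ω / L) = s * (L - R ω) := by field_simp
    rw [e2, e3] at hh
    have e4 : Real.exp (s * (L - R ω)) = Real.exp (-(s * R ω)) * Real.exp (s * L) := by
      rw [← Real.exp_add]; ring_nf
    have hfin : Real.exp (s * (Y ω - R ω)) ≤ Real.exp ((s * L) ^ 2 / 8)
        + (Real.exp (-(s * R ω)) * ((Real.exp (s * L) - 1) / L)) * (Y ω - R ω) := by
      refine hcv.trans ?_
      rw [e4] at hh ⊢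
      have : (1 - Y ω / L) * Real.exp (-(s * R ω)) +
          Y ω / L * (Real.exp (-(s * R ω)) * Real.exp (s * L))
          = ((1 - R ω / L) * Real.exp (-(s * R ω)) +
          R ω / L * (Real.exp (-(s * R ω)) * Real.exp (s * L))) +
          (Real.exp (-(s * R ω)) * ((Real.exp (s * L) - 1) / L)) * (Y ω - R ω) := by
        field_simp; ring
      rw [this]
      linarith
    have := mul_le_mul_of_nonneg_left hfin (hG0 ω)
    simp only [c]
    linarith
  calc _ ≤ ∫ ω, (Real.exp ((s * L) ^ 2 / 8) * G ω + c ω * (Y ω - R ω)) ∂μ :=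
        integral_mono_of_nonneg (Filter.Eventually.of_forall fun ω =>
          mul_nonneg (hG0 ω) (Real.exp_pos _).le) ((hGi.const_mul _).add hcXi)
          (Filter.Eventually.of_forall hpt)
    _ = Real.exp ((s * L) ^ 2 / 8) * ∫ ω, G ω ∂μ + ∫ ω, c ω * (Y ω - R ω) ∂μ := by
        have hcXi' : Integrable (fun ω => c ω * (Y ω - R ω)) μ := hcXi
        rw [integral_add (hGi.const_mul _) hcXi', integral_const_mul]
    _ ≤ _ := by linarith

lemma aux_total {Ω 𝒜 : Type*} [m0 : MeasurableSpace Ω] [Fintype 𝒜]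
    (μ : Measure Ω) [IsProbabilityMeasure μ] (n m : ℕ)
    (F : ℕ → ℕ → MeasurableSpace Ω) (hFle : ∀ i j, F i j ≤ m0)
    (hFmono₁ : ∀ i j, F i j ≤ F i (j + 1)) (hFmono₂ : ∀ i, F i m ≤ F (i + 1) 0)
    (Y : ℕ → ℕ → 𝒜 → Ω → ℝ) (R : ℕ → 𝒜 → Ω → ℝ) (L s : ℝ) (hL : 1 ≤ L) (hs : 0 ≤ s)
    (hY : ∀ i k a, Measurable[F i (k + 1)] (Y i k a))
    (hY0 : ∀ i k a ω, 0 ≤ Y i k a ω) (hYL : ∀ i k a ω, Y i k a ω ≤ L)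
    (hR : ∀ i a, Measurable[F i 0] (R i a)) (hR0 : ∀ i a ω, 0 ≤ R i a ω)
    (hR1 : ∀ i a ω, R i a ω ≤ 1)
    (hsup : ∀ i k a, i < n → k < m → ∀ᵐ ω ∂μ, (μ[fun ω => Y i k a ω - R i a ω | F i k]) ω ≤ 0)
    (p : 𝒜 → ℝ) (hp : ∀ a, 0 < p a) (hp1 : ∑ a, p a = 1) :
    ∫ ω, ∏ i ∈ Finset.range n, ∑ a, p a *
        Real.exp (s * ∑ k ∈ Finset.range m, (Y i k a ω - R i a ω)) ∂μ
      ≤ (Real.exp ((s * L) ^ 2 / 8) ^ m) ^ n := by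
  have hmono : ∀ i, Monotone (F i) := fun i => monotone_nat_of_le_succ (hFmono₁ i)
  have hSm : ∀ i a K, Measurable[F i K] fun ω =>
      Real.exp (s * ∑ k ∈ Finset.range K, (Y i k a ω - R i a ω)) := by
    intro i a K
    refine Real.measurable_exp.comp (Measurable.const_mul ?_ s)
    refine Finset.measurable_fun_sum _ fun k hk => ?_
    exact ((hY i k a).mono (hmono i (Finset.mem_range.1 hk)) le_rfl).sub
      ((hR i a).mono (hmono i (Nat.zero_le _)) le_rfl)
  have hSb : ∀ i a K ω, Real.exp (s * ∑ k ∈ Finset.range K, (Y i k a ω - R i a ω))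
      ≤ Real.exp (s * (K * L)) := by
    intro i a K ω
    apply Real.exp_le_exp.2
    apply mul_le_mul_of_nonneg_left _ hs
    calc _ ≤ ∑ k ∈ Finset.range K, L := Finset.sum_le_sum fun k _ => by
          linarith [hYL i k a ω, hR0 i a ω]
      _ = _ := by simp
  have hinner : ∀ i a, i < n → ∀ (G : Ω → ℝ) (B : ℝ), Measurable[F i 0] G → (∀ ω, 0 ≤ G ω) →
      (∀ ω, G ω ≤ B) → ∀ K ≤ m,
      ∫ ω, G ω * Real.exp (s * ∑ k ∈ Finset.range K, (Y i k a ω - R i a ω)) ∂μ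
        ≤ Real.exp ((s * L) ^ 2 / 8) ^ K * ∫ ω, G ω ∂μ := by
    intro i a hi G B hG hG0 hGB K
    induction K with
    | zero => intro _; simp
    | succ K ih =>
      intro hK
      have hst := aux_step μ (F i K) (hFle i K) (Y i K a) (R i a)
        (fun ω => G ω * Real.exp (s * ∑ k ∈ Finset.range K, (Y i k a ω - R i a ω))) L s
        (B * Real.exp (s * (K * L))) hL hs ((hY i K a).mono (hFle _ _) le_rfl) (hY0 i K a)
        (hYL i K a) ((hR i a).mono (hmono i (Nat.zero_le _)) le_rfl) (hR0 i a) (hR1 i a)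
        ((hG.mono (hmono i (Nat.zero_le _)) le_rfl).mul (hSm i a K))
        (fun ω => mul_nonneg (hG0 ω) (Real.exp_pos _).le)
        (fun ω => mul_le_mul (hGB ω) (hSb i a K ω) (Real.exp_pos _).le
          ((hG0 ω).trans (hGB ω))) (hsup i K a hi (by omega))
      have e : ∀ ω, G ω * Real.exp (s * ∑ k ∈ Finset.range (K + 1), (Y i k a ω - R i a ω))
          = G ω * Real.exp (s * ∑ k ∈ Finset.range K, (Y i k a ω - R i a ω))
            * Real.exp (s * (Y i K a ω - R i a ω)) := by
        intro ω
        rw [Finset.sum_range_succ, mul_add, Real.exp_add, mul_assoc]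
      simp only [e]
      refine hst.trans ?_
      rw [pow_succ' _ K, mul_assoc]
      exact mul_le_mul_of_nonneg_left (ih (by omega)) (Real.exp_pos _).le
  have hW0 : ∀ i ω, 0 ≤ ∑ a, p a *
        Real.exp (s * ∑ k ∈ Finset.range m, (Y i k a ω - R i a ω)) := fun i ω =>
    Finset.sum_nonneg fun a _ => mul_nonneg (hp a).le (Real.exp_pos _).le
  have hWb : ∀ i ω, ∑ a, p a *
        Real.exp (s * ∑ k ∈ Finset.range m, (Y i k a ω - R i a ω)) ≤ Real.exp (s * (m * L)) := by
    intro i ω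
    calc _ ≤ ∑ a, p a * Real.exp (s * (m * L)) := Finset.sum_le_sum fun a _ =>
          mul_le_mul_of_nonneg_left (hSb i a m ω) (hp a).le
      _ = _ := by rw [← Finset.sum_mul, hp1, one_mul]
  have hWm : ∀ i, Measurable[F i m] fun ω => ∑ a, p a *
        Real.exp (s * ∑ k ∈ Finset.range m, (Y i k a ω - R i a ω)) := fun i =>
    Finset.measurable_fun_sum _ fun a _ => (hSm i a m).const_mul _
  have hPm : ∀ N, Measurable[F N 0] fun ω => ∏ i ∈ Finset.range N, ∑ a, p a *
        Real.exp (s * ∑ k ∈ Finset.range m, (Y i k a ω - R i a ω)) := by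
    intro N
    induction N with
    | zero => simp
    | succ N ih =>
      simp only [Finset.prod_range_succ]
      exact (ih.mono ((hmono N (Nat.zero_le m)).trans (hFmono₂ N)) le_rfl).mul
        ((hWm N).mono (hFmono₂ N) le_rfl)
  have hP0 : ∀ N ω, 0 ≤ ∏ i ∈ Finset.range N, ∑ a, p a *
        Real.exp (s * ∑ k ∈ Finset.range m, (Y i k a ω - R i a ω)) := fun N ω =>
    Finset.prod_nonneg fun i _ => hW0 i ω
  have hPb : ∀ N ω, ∏ i ∈ Finset.range N, ∑ a, p a *
        Real.exp (s * ∑ k ∈ Finset.range m, (Y i k a ω - R i a ω))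
        ≤ Real.exp (s * (m * L)) ^ N := by
    intro N ω
    calc _ ≤ ∏ i ∈ Finset.range N, Real.exp (s * (m * L)) :=
          Finset.prod_le_prod (fun i _ => hW0 i ω) fun i _ => hWb i ω
      _ = _ := by simp
  have main : ∀ N ≤ n, ∫ ω, ∏ i ∈ Finset.range N, ∑ a, p a *
        Real.exp (s * ∑ k ∈ Finset.range m, (Y i k a ω - R i a ω)) ∂μ
      ≤ (Real.exp ((s * L) ^ 2 / 8) ^ m) ^ N := by
    intro N
    induction N with
    | zero => intro _; simp
    | succ N ih =>
      intro hN
      simp only [Finset.prod_range_succ]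
      set G : Ω → ℝ := fun ω => ∏ i ∈ Finset.range N, ∑ a, p a *
        Real.exp (s * ∑ k ∈ Finset.range m, (Y i k a ω - R i a ω)) with hGdef
      have e : ∀ ω, G ω * ∑ a, p a *
          Real.exp (s * ∑ k ∈ Finset.range m, (Y N k a ω - R N a ω))
          = ∑ a, p a * (G ω * Real.exp (s * ∑ k ∈ Finset.range m, (Y N k a ω - R N a ω))) := by
        intro ω
        rw [Finset.mul_sum]
        exact Finset.sum_congr rfl fun a _ => by ring
      have hii : ∀ a, Integrable (fun ω => G ω *
          Real.exp (s * ∑ k ∈ Finset.range m, (Y N k a ω - R N a ω))) μ := by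
        intro a
        refine Integrable.of_bound ((((hPm N).mono (hFle _ _) le_rfl).mul
          ((hSm N a m).mono (hFle _ _) le_rfl)).aestronglyMeasurable)
          (Real.exp (s * (m * L)) ^ N * Real.exp (s * (m * L)))
          (Filter.Eventually.of_forall fun ω => ?_)
        rw [Real.norm_eq_abs, abs_of_nonneg (mul_nonneg (hP0 N ω) (Real.exp_pos _).le)]
        exact mul_le_mul (hPb N ω) (hSb N a m ω) (Real.exp_pos _).le (by positivity)
      calc ∫ ω, G ω * ∑ a, p a *
          Real.exp (s * ∑ k ∈ Finset.range m, (Y N k a ω - R N a ω)) ∂μ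
          = ∑ a, p a * ∫ ω, G ω *
            Real.exp (s * ∑ k ∈ Finset.range m, (Y N k a ω - R N a ω)) ∂μ := by
            simp only [e]
            rw [integral_finsetSum _ fun a _ => (hii a).const_mul _]
            simp only [integral_const_mul]
        _ ≤ ∑ a, p a * (Real.exp ((s * L) ^ 2 / 8) ^ m * ∫ ω, G ω ∂μ) :=
            Finset.sum_le_sum fun a _ => mul_le_mul_of_nonneg_left
              (hinner N a (by omega) G _ (hPm N) (hP0 N) (hPb N) m le_rfl) (hp a).le
        _ = Real.exp ((s * L) ^ 2 / 8) ^ m * ∫ ω, G ω ∂μ := by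
            rw [← Finset.sum_mul, hp1, one_mul]
        _ ≤ _ := by
            rw [pow_succ' _ N]
            exact mul_le_mul_of_nonneg_left (ih (by omega)) (by positivity)
  exact main n le_rfl

/-- PAC-Bayesian bound relating the expected multi-task reward `R̃(Qm)` to the
clipped empirical multi-task reward `R̂_τ(Qm)` in the lifelong bandit setting.
Here `ω` encodes the random tasks and datasets: `D i j ω` is the `(j+1)`-th
action-reward pair of task `i+1`, `b i j ω` is the corresponding behaviour
policy, `Rtask i ω a` is the expected reward of action `a` in task `i+1`,
`Apost i j θ ω` is the posterior `A(D_{i+1}^{:j}, P_θ)` returned by the base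
learner, `prior θ` is the prior `P_θ`, `F i j` is the σ-algebra generated by
`D₁, …, D_i, D_{i+1}^{:j}`, and `Pm` is the hyperprior. -/
theorem stmt_17 {Ω Θ 𝒜 : Type*} [m0 : MeasurableSpace Ω] [MeasurableSpace Θ]
    [Fintype 𝒜] [DecidableEq 𝒜] [MeasurableSpace 𝒜] [MeasurableSingletonClass 𝒜]
    (μ : Measure Ω) [IsProbabilityMeasure μ]
    (n m : ℕ) (hn : 0 < n) (hm : 0 < m)
    (F : ℕ → ℕ → MeasurableSpace Ω) (hFle : ∀ i j, F i j ≤ m0)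
    (hFmono₁ : ∀ i j, F i j ≤ F i (j + 1)) (hFmono₂ : ∀ i, F i m ≤ F (i + 1) 0)
    (D : ℕ → ℕ → Ω → 𝒜 × ℝ)
    (hDmeas : ∀ i j, Measurable[F i (j + 1)] (D i j))
    (hr01 : ∀ i j ω, (D i j ω).2 ∈ Set.Icc (0 : ℝ) 1)
    (b : ℕ → ℕ → Ω → 𝒜 → ℝ)
    (hbpos : ∀ i j ω a, 0 < b i j ω a)
    (hbmeas : ∀ i j a, Measurable[F i j] fun ω => b i j ω a)
    (Rtask : ℕ → Ω → 𝒜 → ℝ)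
    (hRtask01 : ∀ i ω a, Rtask i ω a ∈ Set.Icc (0 : ℝ) 1)
    (hRtaskmeas : ∀ i a, Measurable[F i 0] fun ω => Rtask i ω a)
    (τ lam δ : ℝ) (hτ : 0 < τ) (hlam : 0 < lam) (hδ : δ ∈ Set.Ioc (0 : ℝ) 1)
    (hsuper : ∀ i j a, i < n → j < m →
      ∀ᵐ ω ∂μ, (μ[fun ω' =>
          min ((b i j ω' (D i j ω').1)⁻¹) (1 + τ) * (if (D i j ω').1 = a then 1 else 0)
            * (D i j ω').2 - Rtask i ω' a | F i j]) ω ≤ 0)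
    (Apost : ℕ → ℕ → Θ → Ω → 𝒜 → ℝ)
    (hApos : ∀ i j θ ω a, 0 ≤ Apost i j θ ω a)
    (hAsum : ∀ i j θ ω, ∑ a, Apost i j θ ω a = 1)
    (hAmeas : ∀ i j a, Measurable fun p : Θ × Ω => Apost i j p.1 p.2 a)
    (prior : Θ → 𝒜 → ℝ) (hprior : ∀ θ a, 0 < prior θ a)
    (hpriorsum : ∀ θ, ∑ a, prior θ a = 1)
    (hpriormeas : ∀ a, Measurable fun θ => prior θ a)
    (Pm : Measure Θ) [IsProbabilityMeasure Pm] :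
    (1 : ℝ≥0∞) - ENNReal.ofReal δ ≤
      μ {ω | ∀ Qm : Measure Θ, IsProbabilityMeasure Qm → Qm ≪ Pm →
        Integrable (fun θ => Real.log ((Qm.rnDeriv Pm θ).toReal)) Qm →
        Integrable (fun θ => ∑ i ∈ Finset.range n, ∑ j ∈ Finset.range m, ∑ a,
          Apost i j θ ω a * Real.log (Apost i j θ ω a / prior θ a)) Qm →
        Integrable (fun θ => ∑ i ∈ Finset.range n, ∑ j ∈ Finset.range m, ∑ a,
          Apost i j θ ω a * Rtask i ω a) Qm →
        Integrable (fun θ => ∑ i ∈ Finset.range n, ∑ j ∈ Finset.range m, ∑ a,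
          Apost i j θ ω a * ((m : ℝ)⁻¹ * ∑ k ∈ Finset.range m,
            min ((b i k ω (D i k ω).1)⁻¹) (1 + τ) * (if (D i k ω).1 = a then 1 else 0)
              * (D i k ω).2)) Qm →
        (∫ θ, ((n : ℝ) * m)⁻¹ * ∑ i ∈ Finset.range n, ∑ j ∈ Finset.range m, ∑ a,
            Apost i j θ ω a * Rtask i ω a ∂Qm)
          ≥ (∫ θ, ((n : ℝ) * m)⁻¹ * ∑ i ∈ Finset.range n, ∑ j ∈ Finset.range m, ∑ a,
              Apost i j θ ω a * ((m : ℝ)⁻¹ * ∑ k ∈ Finset.range m,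
                min ((b i k ω (D i k ω).1)⁻¹) (1 + τ)
                  * (if (D i k ω).1 = a then 1 else 0) * (D i k ω).2) ∂Qm)
            - ((n : ℝ) * lam)⁻¹ * (∫ θ, Real.log ((Qm.rnDeriv Pm θ).toReal) ∂Qm)
            - ((n : ℝ) * m * lam)⁻¹ * (∫ θ, ∑ i ∈ Finset.range n, ∑ j ∈ Finset.range m,
                ∑ a, Apost i j θ ω a * Real.log (Apost i j θ ω a / prior θ a) ∂Qm)
            - lam * (1 + τ) ^ 2 / (8 * m)
            - ((n : ℝ) * lam)⁻¹ * Real.log (m / δ)} := by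
  have hm0 : (0 : ℝ) < m := by exact_mod_cast hm
  have hn0 : (0 : ℝ) < n := by exact_mod_cast hn
  obtain ⟨hδ0, hδ1⟩ := hδ
  have hm1 : (1 : ℝ) ≤ m := by exact_mod_cast hm
  set Y : ℕ → ℕ → 𝒜 → Ω → ℝ := fun i k a ω =>
    min ((b i k ω (D i k ω).1)⁻¹) (1 + τ) * (if (D i k ω).1 = a then 1 else 0)
      * (D i k ω).2 with hYdef
  set R : ℕ → 𝒜 → Ω → ℝ := fun i a ω => Rtask i ω a with hRdef
  set s : ℝ := lam / m with hsdef
  set L : ℝ := 1 + τ with hLdef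
  have hs : 0 < s := div_pos hlam hm0
  have hL : 1 ≤ L := by simp only [hLdef]; linarith
  have hY : ∀ i k a, Measurable[F i (k + 1)] (Y i k a) := by
    intro i k a
    have e : Y i k a = fun ω => min ((b i k ω a)⁻¹) L *
        (if (D i k ω).1 = a then 1 else 0) * (D i k ω).2 := by
      funext ω
      simp only [hYdef]
      by_cases h : (D i k ω).1 = a
      · rw [h]
      · simp [h]
    rw [e]
    have hb' : Measurable[F i (k + 1)] fun ω => b i k ω a :=
      (hbmeas i k a).mono (hFmono₁ i k) le_rfl
    have h1 : Measurable[F i (k + 1)] fun ω => (D i k ω).1 := measurable_fst.comp (hDmeas i k)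
    have h2 : Measurable[F i (k + 1)] fun ω => (D i k ω).2 := measurable_snd.comp (hDmeas i k)
    refine ((hb'.inv.min measurable_const).mul ?_).mul h2
    exact Measurable.ite (h1 (measurableSet_singleton a)) measurable_const measurable_const
  have hmin0 : ∀ i k ω, 0 ≤ min ((b i k ω (D i k ω).1)⁻¹) L := fun i k ω =>
    le_min (inv_nonneg.2 (hbpos _ _ _ _).le) (by linarith)
  have hY0 : ∀ i k a ω, 0 ≤ Y i k a ω := by
    intro i k a ω
    refine mul_nonneg (mul_nonneg (hmin0 i k ω) ?_) (hr01 i k ω).1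
    split_ifs <;> norm_num
  have hYL : ∀ i k a ω, Y i k a ω ≤ L := by
    intro i k a ω
    have h1 : (if (D i k ω).1 = a then (1 : ℝ) else 0) ≤ 1 := by split_ifs <;> norm_num
    have h0 : 0 ≤ (if (D i k ω).1 = a then (1 : ℝ) else 0) := by split_ifs <;> norm_num
    calc Y i k a ω ≤ L * 1 * 1 := by
          refine mul_le_mul (mul_le_mul (min_le_right _ _) h1 h0 (by linarith))
            (hr01 i k ω).2 (hr01 i k ω).1 (by linarith)
      _ = L := by ring
  have hR0 : ∀ i a ω, 0 ≤ R i a ω := fun i a ω => (hRtask01 i ω a).1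
  have hR1 : ∀ i a ω, R i a ω ≤ 1 := fun i a ω => (hRtask01 i ω a).2
  let g : ℕ → 𝒜 → Ω → ℝ := fun i a ω => s * ∑ k ∈ Finset.range m, (Y i k a ω - R i a ω)
  have hgm : ∀ i a, Measurable (g i a) := fun i a =>
    Measurable.const_mul (Finset.measurable_fun_sum _ fun k _ =>
      ((hY i k a).mono (hFle _ _) le_rfl).sub ((hRtaskmeas i a).mono (hFle _ _) le_rfl)) s
  have hgb : ∀ i a ω, |g i a ω| ≤ s * (m * L) := by
    intro i a ω
    simp only [g]
    rw [abs_mul, abs_of_pos hs]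
    apply mul_le_mul_of_nonneg_left _ hs.le
    calc _ ≤ ∑ k ∈ Finset.range m, |Y i k a ω - R i a ω| := Finset.abs_sum_le_sum_abs _ _
      _ ≤ ∑ k ∈ Finset.range m, L := Finset.sum_le_sum fun k _ => by
          rw [abs_le]
          constructor <;> linarith [hY0 i k a ω, hYL i k a ω, hR0 i a ω, hR1 i a ω]
      _ = _ := by simp
  let W : ℕ → Ω → Θ → ℝ := fun i ω θ => ∑ a, prior θ a * Real.exp (g i a ω)
  have hWm : ∀ i, Measurable (Function.uncurry (W i)) := by
    intro i
    refine Finset.measurable_fun_sum _ fun a _ => ?_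
    exact ((hpriormeas a).comp measurable_snd).mul (((hgm i a).comp measurable_fst).exp)
  have hWub : ∀ i ω θ, W i ω θ ≤ Real.exp (s * (m * L)) := by
    intro i ω θ
    calc _ ≤ ∑ a, prior θ a * Real.exp (s * (m * L)) := Finset.sum_le_sum fun a _ =>
          mul_le_mul_of_nonneg_left (Real.exp_le_exp.2 (abs_le.1 (hgb i a ω)).2) (hprior θ a).le
      _ = _ := by rw [← Finset.sum_mul, hpriorsum, one_mul]
  have hWlb : ∀ i ω θ, Real.exp (-(s * (m * L))) ≤ W i ω θ := by
    intro i ω θ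
    calc _ = ∑ a, prior θ a * Real.exp (-(s * (m * L))) := by
            rw [← Finset.sum_mul, hpriorsum, one_mul]
      _ ≤ _ := Finset.sum_le_sum fun a _ =>
          mul_le_mul_of_nonneg_left (Real.exp_le_exp.2 (abs_le.1 (hgb i a ω)).1) (hprior θ a).le
  have hWpos : ∀ i ω θ, 0 < W i ω θ := fun i ω θ => (Real.exp_pos _).trans_le (hWlb i ω θ)
  let h : Ω → Θ → ℝ := fun ω θ => ∑ i ∈ Finset.range n, Real.log (W i ω θ)
  have hhm : Measurable (Function.uncurry h) :=
    Finset.measurable_fun_sum _ fun i _ => (hWm i).log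
  have hhm' : ∀ ω, Measurable (h ω) := fun ω => hhm.comp measurable_prodMk_left
  have hhb : ∀ ω θ, |h ω θ| ≤ n * (s * (m * L)) := by
    intro ω θ
    calc _ ≤ ∑ i ∈ Finset.range n, |Real.log (W i ω θ)| := Finset.abs_sum_le_sum_abs _ _
      _ ≤ ∑ i ∈ Finset.range n, s * (m * L) := Finset.sum_le_sum fun i _ => by
          rw [abs_le]
          exact ⟨(Real.le_log_iff_exp_le (hWpos i ω θ)).2 (hWlb i ω θ),
            (Real.log_le_iff_le_exp (hWpos i ω θ)).2 (hWub i ω θ)⟩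
      _ = _ := by simp
  have hexp : ∀ ω θ, Real.exp (h ω θ) = ∏ i ∈ Finset.range n, W i ω θ := by
    intro ω θ
    simp only [h]
    rw [Real.exp_sum]
    exact Finset.prod_congr rfl fun i _ => Real.exp_log (hWpos i ω θ)
  have hIexp : Integrable (Function.uncurry fun ω θ => Real.exp (h ω θ)) (μ.prod Pm) := by
    refine Integrable.of_bound (hhm.exp).aestronglyMeasurable (Real.exp (n * (s * (m * L))))
      (Filter.Eventually.of_forall fun x => ?_)
    rw [Real.norm_eq_abs]
    simp only [Function.uncurry]
    rw [Real.abs_exp]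
    exact Real.exp_le_exp.2 ((le_abs_self _).trans (hhb x.1 x.2))
  let Z : Ω → ℝ := fun ω => ∫ θ, Real.exp (h ω θ) ∂Pm
  have hZm : Measurable Z :=
    (StronglyMeasurable.integral_prod_right (f := fun ω θ => Real.exp (h ω θ))
      (hhm.exp.stronglyMeasurable)).measurable
  have hZi : Integrable Z μ := hIexp.integral_prod_left
  have hZpos : ∀ ω, 0 < Z ω := by
    intro ω
    apply integral_exp_pos
    refine Integrable.of_bound (hhm' ω).exp.aestronglyMeasurable (Real.exp (n * (s * (m * L))))
      (Filter.Eventually.of_forall fun θ => ?_)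
    rw [Real.norm_eq_abs, Real.abs_exp]
    exact Real.exp_le_exp.2 ((le_abs_self _).trans (hhb ω θ))
  set C : ℝ := (Real.exp ((s * L) ^ 2 / 8) ^ m) ^ n with hC
  have hCpos : 0 < C := by positivity
  have hZint : ∫ ω, Z ω ∂μ ≤ C := by
    simp only [Z]
    rw [integral_integral_swap hIexp]
    have hθ : ∀ θ, ∫ ω, Real.exp (h ω θ) ∂μ ≤ C := by
      intro θ
      simp only [hexp]
      exact aux_total μ n m F hFle hFmono₁ hFmono₂ Y R L s hL hs.le hY hY0 hYL hRtaskmeas hR0 hR1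
        hsuper (prior θ) (hprior θ) (hpriorsum θ)
    calc _ ≤ ∫ _θ, C ∂Pm := integral_mono_of_nonneg
          (Filter.Eventually.of_forall fun θ => integral_nonneg fun ω => (Real.exp_pos _).le)
          (integrable_const _) (Filter.Eventually.of_forall hθ)
      _ = C := by simp
  have hmk := mul_meas_ge_le_integral_of_nonneg
    (Filter.Eventually.of_forall fun ω => (hZpos ω).le) hZi (C / δ)
  have hbad : μ.real {ω | C / δ ≤ Z ω} ≤ δ := by
    have h1 := hmk.trans hZint
    rw [div_mul_eq_mul_div, div_le_iff₀ hδ0] at h1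
    exact le_of_mul_le_mul_left h1 hCpos
  have hbadm : MeasurableSet {ω | C / δ ≤ Z ω} := measurableSet_le measurable_const hZm
  have hbad' : μ {ω | C / δ ≤ Z ω} ≤ ENNReal.ofReal δ := by
    rw [← ENNReal.ofReal_toReal (measure_ne_top μ _)]
    exact ENNReal.ofReal_le_ofReal hbad
  calc (1 : ℝ≥0∞) - ENNReal.ofReal δ ≤ 1 - μ {ω | C / δ ≤ Z ω} := tsub_le_tsub_left hbad' 1
    _ = μ {ω | C / δ ≤ Z ω}ᶜ := (prob_compl_eq_one_sub hbadm).symm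
    _ ≤ _ := measure_mono ?_
  intro ω hω
  simp only [Set.mem_compl_iff, Set.mem_setOf_eq, not_le] at hω
  simp only [Set.mem_setOf_eq]
  intro Q hQ hQP hKL hT3 hT1 hT2
  have hDV := aux_DV Pm Q hQP hKL (h ω) (hhm' ω) _ (hhb ω)
  have hlogZ : Real.log (Z ω) ≤ n * (lam ^ 2 * L ^ 2 / (8 * m)) + Real.log (m / δ) := by
    calc Real.log (Z ω) ≤ Real.log (C / δ) := Real.log_le_log (hZpos ω) hω.le
      _ = Real.log C - Real.log δ := Real.log_div hCpos.ne' hδ0.ne'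
      _ = n * (lam ^ 2 * L ^ 2 / (8 * m)) - Real.log δ := by
          rw [hC, Real.log_pow, Real.log_pow, Real.log_exp, hsdef]
          congr 1
          field_simp
      _ ≤ _ := by
          rw [Real.log_div hm0.ne' hδ0.ne']
          linarith [Real.log_nonneg hm1]
  have hhi : Integrable (h ω) Q := Integrable.of_bound (hhm' ω).aestronglyMeasurable _
    (Filter.Eventually.of_forall (hhb ω))
  have hpt : ∀ θ, lam * ((∑ i ∈ Finset.range n, ∑ j ∈ Finset.range m, ∑ a,
          Apost i j θ ω a * ((m : ℝ)⁻¹ * ∑ k ∈ Finset.range m, Y i k a ω))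
        - ∑ i ∈ Finset.range n, ∑ j ∈ Finset.range m, ∑ a, Apost i j θ ω a * R i a ω)
      ≤ (∑ i ∈ Finset.range n, ∑ j ∈ Finset.range m, ∑ a,
          Apost i j θ ω a * Real.log (Apost i j θ ω a / prior θ a)) + m * h ω θ := by
    intro θ
    have e1 : lam * ((∑ i ∈ Finset.range n, ∑ j ∈ Finset.range m, ∑ a,
          Apost i j θ ω a * ((m : ℝ)⁻¹ * ∑ k ∈ Finset.range m, Y i k a ω))
        - ∑ i ∈ Finset.range n, ∑ j ∈ Finset.range m, ∑ a, Apost i j θ ω a * R i a ω)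
        = ∑ i ∈ Finset.range n, ∑ j ∈ Finset.range m, ∑ a, Apost i j θ ω a * g i a ω := by
      simp only [← Finset.sum_sub_distrib]
      rw [Finset.mul_sum]
      refine Finset.sum_congr rfl fun i _ => ?_
      rw [Finset.mul_sum]
      refine Finset.sum_congr rfl fun j _ => ?_
      rw [Finset.mul_sum]
      refine Finset.sum_congr rfl fun a _ => ?_
      simp only [g, Finset.sum_sub_distrib, Finset.sum_const, Finset.card_range, nsmul_eq_mul,
        hsdef]
      field_simp
    have e2 : (m : ℝ) * h ω θ = ∑ i ∈ Finset.range n, ∑ j ∈ Finset.range m,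
        Real.log (W i ω θ) := by
      simp only [h, Finset.sum_const, Finset.card_range, nsmul_eq_mul, Finset.mul_sum]
    rw [e1, e2]
    simp only [← Finset.sum_add_distrib]
    exact Finset.sum_le_sum fun i _ => Finset.sum_le_sum fun j _ =>
      aux_finDV (Apost i j θ ω) (prior θ) (fun a => g i a ω) (hApos i j θ ω) (hAsum i j θ ω)
        (hprior θ)
  have hI := integral_mono ((hT2.sub hT1).const_mul lam) (hT3.add (hhi.const_mul m)) hpt
  rw [integral_const_mul, integral_sub' hT2 hT1, integral_add' hT3 (hhi.const_mul m),
    integral_const_mul] at hI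
  rw [integral_const_mul, integral_const_mul]
  change Real.log (∫ θ, Real.exp (h ω θ) ∂Pm) ≤ _ at hlogZ
  have hfin := hI.trans (add_le_add_right (mul_le_mul_of_nonneg_left
    (hDV.trans (add_le_add_right hlogZ _)) hm0.le) _)
  generalize (∫ θ, ∑ i ∈ Finset.range n, ∑ j ∈ Finset.range m, ∑ a,
    Apost i j θ ω a * Real.log (Apost i j θ ω a / prior θ a) ∂Q) = T3 at hfin ⊢
  generalize (∫ θ, Real.log ((Q.rnDeriv Pm θ).toReal) ∂Q) = K at hfin ⊢
  generalize Real.log (m / δ) = l at hfin ⊢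
  generalize (∫ θ, ∑ i ∈ Finset.range n, ∑ j ∈ Finset.range m, ∑ a,
    Apost i j θ ω a * Rtask i ω a ∂Q) = T1 at hfin ⊢
  generalize (∫ θ, ∑ i ∈ Finset.range n, ∑ j ∈ Finset.range m, ∑ a,
    Apost i j θ ω a * ((m : ℝ)⁻¹ * ∑ k ∈ Finset.range m, Y i k a ω) ∂Q) = T2 at hfin ⊢
  have hq := mul_le_mul_of_nonneg_left hfin (show 0 ≤ ((n : ℝ) * m * lam)⁻¹ by positivity)
  have e3 : ((n : ℝ) * m * lam)⁻¹ * (lam * (T2 - T1)) = ((n : ℝ) * m)⁻¹ * T2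
      - ((n : ℝ) * m)⁻¹ * T1 := by field_simp
  have e4 : ((n : ℝ) * m * lam)⁻¹ * (T3 + m * (K + (n * (lam ^ 2 * L ^ 2 / (8 * m)) + l)))
      = ((n : ℝ) * lam)⁻¹ * K + ((n : ℝ) * m * lam)⁻¹ * T3 + lam * L ^ 2 / (8 * m)
        + ((n : ℝ) * lam)⁻¹ * l := by field_simp; ring
  rw [e3, e4] at hq
  linarith
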